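/- Let Ω be a non-obtuse triangle in ℝ², i.e., the convex hull of three affinely independent points A, B, C with (B−A)·(C−A) ≥ 0, (A−B)·(C−B) ≥ 0, (A−C)·(B−C) ≥ 0. Then for every h > 0, Ω has a unique illuminating center of height h, i.e., the function x ↦ A_Ω(x,h) has exactly one maximum point in ℝ². -/

import Mathlib

open Set MeasureTheory Filter Asymptotics Metric
open scoped Topology RealInnerProductSpace

noncomputable section

/-- `m`-dimensional Euclidean space. -/
abbrev Euc (m : ℕ) := EuclideanSpace ℝ (Fin m)

/-- A body: the closure of a nonempty bounded open set. -/
def IsBody {m : ℕ} (Ω : Set (Euc m)) : Prop :=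
  ∃ U : Set (Euc m), IsOpen U ∧ U.Nonempty ∧ Bornology.IsBounded U ∧ Ω = closure U

/-- The potential `K_Ω(x) = ∫_Ω k(|x - y|) dy`. -/
def pot {m : ℕ} (k : ℝ → ℝ) (Ω : Set (Euc m)) (x : Euc m) : ℝ :=
  ∫ y in Ω, k (dist x y)

/-- Condition `(C⁰_α)`. -/
def CondC0 (m : ℕ) (α : ℝ) (k : ℝ → ℝ) : Prop :=
  ContinuousOn k (Ioi 0) ∧
  (α < m → k =O[𝓝[>] (0:ℝ)] fun r : ℝ => r ^ (α - m)) ∧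
  (α = m → k =O[𝓝[>] (0:ℝ)] fun r : ℝ => Real.log r) ∧
  ((m : ℝ) < α → k =O[𝓝[>] (0:ℝ)] fun _ : ℝ => (1:ℝ))

/-- Condition `(C¹_α)`. -/
def CondC1 (m : ℕ) (α : ℝ) (k : ℝ → ℝ) : Prop :=
  ContDiffOn ℝ 1 k (Ioi 0) ∧
  (α < m → k =O[𝓝[>] (0:ℝ)] fun r : ℝ => r ^ (α - m)) ∧
  (α = m → k =O[𝓝[>] (0:ℝ)] fun r : ℝ => Real.log r) ∧
  ((m : ℝ) < α → k =O[𝓝[>] (0:ℝ)] fun _ : ℝ => (1:ℝ)) ∧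
  (α < m + 1 → deriv k =O[𝓝[>] (0:ℝ)] fun r : ℝ => r ^ (α - m - 1)) ∧
  (α = m + 1 → deriv k =O[𝓝[>] (0:ℝ)] fun r : ℝ => Real.log r) ∧
  ((m : ℝ) + 1 < α → deriv k =O[𝓝[>] (0:ℝ)] fun _ : ℝ => (1:ℝ))

/-- Reflection of `ℝ^m` in the hyperplane `{z : z ⬝ v = b}` (for a unit vector `v`). -/
def reflAt {m : ℕ} (v : Euc m) (b : ℝ) (z : Euc m) : Euc m :=
  z + (2 * (b - ⟪z, v⟫)) • v

/-- `Ω⁺_{v,b}`, the part of `Ω` of height at least `b` in direction `v`. -/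
def upSet {m : ℕ} (Ω : Set (Euc m)) (v : Euc m) (b : ℝ) : Set (Euc m) :=
  {z ∈ Ω | b ≤ ⟪z, v⟫}

/-- The minimum folding height `l(v)`. -/
def foldHeight {m : ℕ} (Ω : Set (Euc m)) (v : Euc m) : ℝ :=
  sInf {a : ℝ | ∀ b ≥ a, reflAt v b '' upSet Ω v b ⊆ Ω}

/-- The minimal unfolded region `Uf(Ω)`. -/
def unfolded {m : ℕ} (Ω : Set (Euc m)) : Set (Euc m) :=
  ⋂ v ∈ sphere (0 : Euc m) 1, {z : Euc m | ⟪z, v⟫ ≤ foldHeight Ω v}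

/-- `Ω` is convex in the direction `v`: every line parallel to `v` meets `Ω` in a connected set. -/
def ConvexInDir {m : ℕ} (Ω : Set (Euc m)) (v : Euc m) : Prop :=
  ∀ z : Euc m, ⟪z, v⟫ = 0 → IsPreconnected (Ω ∩ {w : Euc m | ∃ t : ℝ, w = z + t • v})

/-- `d(Ω) = min {|z - w| : z ∈ Uf(Ω), w ∈ ∂Ω}`. -/
def dMin {m : ℕ} (Ω : Set (Euc m)) : ℝ :=
  sInf {d : ℝ | ∃ z ∈ unfolded Ω, ∃ w ∈ frontier Ω, d = dist z w}

/-- `D(Ω) = max {|z - w| : z ∈ Uf(Ω), w ∈ ∂Ω}`. -/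
def dMax {m : ℕ} (Ω : Set (Euc m)) : ℝ :=
  sSup {d : ℝ | ∃ z ∈ unfolded Ω, ∃ w ∈ frontier Ω, d = dist z w}

/-- The `r^{α-m}`-potential `V^{(α)}_Ω`. -/
def rpot (m : ℕ) (α : ℝ) (Ω : Set (Euc m)) (x : Euc m) : ℝ :=
  if α = (m : ℝ) then -∫ y in Ω, Real.log (dist x y)
  else Real.sign ((m : ℝ) - α) * ∫ y in Ω, dist x y ^ (α - (m : ℝ))

/-- The solid-angle (Poisson) potential `A_Ω(x, h)`. -/
def apot (m : ℕ) (Ω : Set (Euc m)) (x : Euc m) (h : ℝ) : ℝ :=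
  ∫ y in Ω, h / (dist x y ^ 2 + h ^ 2) ^ (((m : ℝ) + 1) / 2)

/-- One-dimensional Brunn–Minkowski inequality, compact case. -/
lemma volume_add_le_of_isCompact {A B S : Set ℝ} (hA : IsCompact A) (hB : IsCompact B)
    (nA : A.Nonempty) (nB : B.Nonempty) (h : ∀ x ∈ A, ∀ y ∈ B, (x + y) / 2 ∈ S) :
    volume A + volume B ≤ 2 * volume S := by
  obtain ⟨a, haA, ha⟩ := hA.exists_isGreatest nA
  obtain ⟨b, hbB, hb⟩ := hB.exists_isLeast nB
  have hS : volume ((fun z : ℝ => 2⁻¹ * z) ⁻¹' S) = 2 * volume S := by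
    rw [Real.volume_preimage_mul_left (by norm_num)]
    norm_num
  rw [← hS, ← measure_preimage_add_right volume (-b) A, ← measure_preimage_add_right volume (-a) B,
    ← measure_union₀]
  · refine measure_mono ?_
    rintro z (hz | hz)
    · have := h _ hz _ hbB
      simp only [mem_preimage]
      convert this using 1
      ring
    · have := h _ haA _ hz
      simp only [mem_preimage]
      convert this using 1
      ring
  · exact (hB.measurableSet.preimage (measurable_add_const _)).nullMeasurableSet
  · refine measure_mono_null (t := {a + b}) ?_ (by simp)
    rintro z ⟨hz1, hz2⟩
    have h1 := ha hz1
    have h2 := hb hz2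
    simp only [mem_singleton_iff]
    linarith

/-- One-dimensional Brunn–Minkowski inequality, in midpoint form. -/
lemma volume_add_le_two_mul_volume {A B S : Set ℝ} (hA : MeasurableSet A) (hB : MeasurableSet B)
    (nA : A.Nonempty) (nB : B.Nonempty) (h : ∀ x ∈ A, ∀ y ∈ B, (x + y) / 2 ∈ S) :
    volume A + volume B ≤ 2 * volume S := by
  obtain ⟨a, ha⟩ := nA
  obtain ⟨b, hb⟩ := nB
  have key : ∀ K ⊆ A, IsCompact K → ∀ L ⊆ B, IsCompact L →
      volume K + volume L ≤ 2 * volume S := by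
    intro K hK hKc L hL hLc
    refine le_trans (add_le_add (measure_mono (subset_insert a K))
      (measure_mono (subset_insert b L))) ?_
    exact volume_add_le_of_isCompact (hKc.insert a) (hLc.insert b) (insert_nonempty _ _)
      (insert_nonempty _ _) fun x hx y hy =>
        h x (insert_subset ha hK hx) y (insert_subset hb hL hy)
  have key' : ∀ K ⊆ A, IsCompact K → volume K + volume B ≤ 2 * volume S := by
    intro K hK hKc
    rw [add_comm]
    refine (ENNReal.le_sub_iff_add_le_right hKc.measure_ne_top ?_).1 ?_
    · simpa using key K hK hKc ∅ (empty_subset _) isCompact_empty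
    · rw [hB.measure_eq_iSup_isCompact]
      refine iSup₂_le fun L hL => iSup_le fun hLc => ?_
      refine ENNReal.le_sub_of_add_le_right hKc.measure_ne_top ?_
      rw [add_comm]
      exact key K hK hKc L hL hLc
  have hBS : volume B ≤ 2 * volume S := by
    simpa using key' ∅ (empty_subset _) isCompact_empty
  by_cases hBt : volume B = ⊤
  · rw [hBt, top_le_iff] at hBS
    simp [hBS]
  · refine (ENNReal.le_sub_iff_add_le_right hBt hBS).1 ?_
    rw [hA.measure_eq_iSup_isCompact]
    exact iSup₂_le fun K hK => iSup_le fun hKc =>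
      ENNReal.le_sub_of_add_le_right hBt (key' K hK hKc)

/-- Integrated form of the one-dimensional Brunn–Minkowski inequality for functions of
supremum one. -/
lemma lintegral_add_le_two_mul_lintegral {f g r : ℝ → ℝ} (hfm : Measurable f) (hgm : Measurable g)
    (hrm : Measurable r) (f0 : ∀ x, 0 ≤ f x) (g0 : ∀ x, 0 ≤ g x) (r0 : ∀ x, 0 ≤ r x)
    (f1 : ∀ x, f x ≤ 1) (g1 : ∀ x, g x ≤ 1) (hf : ∀ t < 1, ∃ x, t < f x)
    (hg : ∀ t < 1, ∃ x, t < g x) (h : ∀ x y, min (f x) (g y) ≤ r ((x + y) / 2)) :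
    (∫⁻ x, ENNReal.ofReal (f x)) + ∫⁻ x, ENNReal.ofReal (g x) ≤
      2 * ∫⁻ x, ENNReal.ofReal (r x) := by
  have layer : ∀ q : ℝ → ℝ, Measurable q → (∀ x, 0 ≤ q x) → (∀ x, q x ≤ 1) →
      ∫⁻ x, ENNReal.ofReal (q x) = ∫⁻ t in Ioo (0 : ℝ) 1, volume {x | t < q x} := by
    intro q hq q0 q1
    rw [lintegral_eq_lintegral_meas_lt _ (ae_of_all _ q0) hq.aemeasurable]
    rw [← lintegral_indicator measurableSet_Ioi, ← lintegral_indicator measurableSet_Ioo]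
    refine lintegral_congr fun t => ?_
    rcases lt_or_ge t 1 with ht | ht
    · simp [indicator, ht]
    · have : {x | t < q x} = ∅ := by
        ext x
        simpa using (q1 x).trans ht
      simp [indicator, this]
  rw [layer f hfm f0 f1, layer g hgm g0 g1,
    lintegral_eq_lintegral_meas_lt _ (ae_of_all _ r0) hrm.aemeasurable]
  have anti : ∀ q : ℝ → ℝ, Measurable fun t : ℝ => volume {x | t < q x} := fun q =>
    Antitone.measurable fun s t hst => measure_mono fun x hx => lt_of_le_of_lt hst hx
  rw [← lintegral_add_left (anti f), ← lintegral_const_mul _ (anti r)]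
  refine le_trans ?_ (lintegral_mono_set (fun t (ht : t ∈ Ioo (0 : ℝ) 1) => ht.1))
  refine setLIntegral_mono' measurableSet_Ioo fun t ht => ?_
  refine volume_add_le_two_mul_volume (measurableSet_lt measurable_const hfm)
    (measurableSet_lt measurable_const hgm) (hf t ht.2) (hg t ht.2) fun x hx y hy => ?_
  exact lt_of_lt_of_le (lt_min hx hy) (h x y)

/-- A nonnegative bounded measurable function with bounded support. -/
structure BoundedDensity {E : Type*} [NormedAddCommGroup E] [MeasurableSpace E]
    (u : E → ℝ) : Prop where
  measurable : Measurable u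
  nonneg : ∀ x, 0 ≤ u x
  exists_bound : ∃ C R : ℝ, ∀ x, u x ≤ C ∧ (R < ‖x‖ → u x = 0)

lemma BoundedDensity.bddAbove {E : Type*} [NormedAddCommGroup E] [MeasurableSpace E]
    {u : E → ℝ} (hu : BoundedDensity u) : BddAbove (range u) := by
  obtain ⟨C, R, h⟩ := hu.exists_bound
  exact ⟨C, by rintro _ ⟨x, rfl⟩; exact (h x).1⟩

lemma BoundedDensity.integrable {E : Type*} [NormedAddCommGroup E] [MeasureSpace E]
    [BorelSpace E] [ProperSpace E] [IsFiniteMeasureOnCompacts (volume : Measure E)]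
    {u : E → ℝ} (hu : BoundedDensity u) : Integrable u := by
  obtain ⟨C, R, h⟩ := hu.exists_bound
  have hi : Integrable ((closedBall (0 : E) R).indicator fun _ => C) :=
    (integrable_indicator_iff measurableSet_closedBall).2
      (integrableOn_const (isCompact_closedBall _ _).measure_ne_top)
  refine hi.mono' hu.measurable.aestronglyMeasurable (ae_of_all _ fun x => ?_)
  rw [Real.norm_of_nonneg (hu.nonneg x)]
  by_cases hx : x ∈ closedBall (0 : E) R
  · rw [indicator_of_mem hx]
    exact (h x).1
  · rw [indicator_of_notMem hx]
    exact ((h x).2 (by simpa using hx)).le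

lemma BoundedDensity.slice {u : ℝ × ℝ → ℝ} (hu : BoundedDensity u) (s : ℝ) :
    BoundedDensity fun y => u (s, y) := by
  obtain ⟨C, R, h⟩ := hu.exists_bound
  exact ⟨hu.measurable.comp measurable_prodMk_left, fun y => hu.nonneg _, C, R, fun y =>
    ⟨(h _).1, fun hy => (h _).2 (hy.trans_le (norm_snd_le (s, y)))⟩⟩

lemma BoundedDensity.marginal {u : ℝ × ℝ → ℝ} (hu : BoundedDensity u) :
    BoundedDensity fun s => ∫ y, u (s, y) := by
  obtain ⟨C, R, h⟩ := hu.exists_bound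
  refine ⟨(hu.measurable.stronglyMeasurable.integral_prod_right' (ν := volume)).measurable,
    fun s => integral_nonneg fun y => hu.nonneg _,
    ∫ y, (closedBall (0 : ℝ) R).indicator (fun _ => C) y, R, fun s => ⟨?_, fun hs => ?_⟩⟩
  · refine integral_mono (hu.slice s).integrable
      ((integrable_indicator_iff measurableSet_closedBall).2
        (integrableOn_const (isCompact_closedBall _ _).measure_ne_top)) fun y => ?_
    by_cases hy : y ∈ closedBall (0 : ℝ) R
    · rw [indicator_of_mem hy]
      exact (h _).1
    · rw [indicator_of_notMem hy]
      refine ((h _).2 ?_).le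
      have : R < ‖y‖ := by simpa using hy
      exact this.trans_le (norm_snd_le (s, y))
  · have : ∀ y, u (s, y) = 0 := fun y => (h _).2 (hs.trans_le (norm_fst_le (s, y)))
    simp [this]

/-- `f`, `g`, `r` satisfy the power mean condition of exponent `-1/n` at midpoints. -/
def MidpointPowerMean {E : Type*} [AddCommGroup E] [Module ℝ E] (n : ℕ) (f g r : E → ℝ) : Prop :=
  ∀ x y : E, ∀ α β : ℝ, 0 < α → 0 < β → (α ^ n)⁻¹ ≤ f x → (β ^ n)⁻¹ ≤ g y →
    (((α + β) / 2) ^ n)⁻¹ ≤ r ((2 : ℝ)⁻¹ • (x + y))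

lemma exists_pos_inv_pow_eq {n : ℕ} (hn : n ≠ 0) {a : ℝ} (ha : 0 < a) :
    ∃ α : ℝ, 0 < α ∧ (α ^ n)⁻¹ = a := by
  refine ⟨(a⁻¹) ^ ((n : ℝ)⁻¹), by positivity, ?_⟩
  rw [Real.rpow_inv_natCast_pow (by positivity) hn, inv_inv]

lemma MidpointPowerMean.exists_integral_le {n : ℕ} (hn : n ≠ 0) {f g r : ℝ → ℝ}
    (H : MidpointPowerMean n f g r) (hf : BoundedDensity f) (hg : BoundedDensity g)
    (hr : BoundedDensity r)
    (fp : 0 < ∫ x, f x) (gp : 0 < ∫ x, g x) :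
    ∃ α β : ℝ, 0 < α ∧ 0 < β ∧
      α ^ n * (∫ x, f x) + β ^ n * (∫ x, g x) ≤ 2 * (((α + β) / 2) ^ n * ∫ x, r x) := by
  have sup : ∀ q : ℝ → ℝ, (∀ x, 0 ≤ q x) → BddAbove (range q) → 0 < ∫ x, q x →
      ∃ α : ℝ, 0 < α ∧ (∀ x, α ^ n * q x ≤ 1) ∧ ∀ t < 1, ∃ x, t < α ^ n * q x := by
    intro q q0 qb qp
    have hpos : 0 < ⨆ x, q x := by
      by_contra! hle
      have : q = 0 := funext fun x => le_antisymm ((le_ciSup qb x).trans hle) (q0 x)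
      simp [this] at qp
    obtain ⟨α, hα, h⟩ := exists_pos_inv_pow_eq hn hpos
    have hαn : 0 < α ^ n := by positivity
    refine ⟨α, hα, fun x => ?_, fun t ht => ?_⟩
    · have := le_ciSup qb x
      rw [← h] at this
      calc α ^ n * q x ≤ α ^ n * (α ^ n)⁻¹ := by gcongr
        _ = 1 := mul_inv_cancel₀ hαn.ne'
    · have : t * (α ^ n)⁻¹ < ⨆ x, q x := by
        rw [← h]
        exact mul_lt_of_lt_one_left (by positivity) ht
      obtain ⟨x, hx⟩ := exists_lt_of_lt_ciSup this
      refine ⟨x, ?_⟩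
      rwa [← div_eq_mul_inv, div_lt_iff₀ hαn, mul_comm] at hx
  obtain ⟨α, hα, f1, hf1⟩ := sup f hf.nonneg hf.bddAbove fp
  obtain ⟨β, hβ, g1, hg1⟩ := sup g hg.nonneg hg.bddAbove gp
  refine ⟨α, β, hα, hβ, ?_⟩
  have key := lintegral_add_le_two_mul_lintegral (f := fun x => α ^ n * f x)
    (g := fun x => β ^ n * g x) (r := fun x => ((α + β) / 2) ^ n * r x)
    (hf.measurable.const_mul _) (hg.measurable.const_mul _) (hr.measurable.const_mul _)
    (fun x => mul_nonneg (by positivity) (hf.nonneg x)) (fun x => mul_nonneg (by positivity) (hg.nonneg x))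
    (fun x => mul_nonneg (by positivity) (hr.nonneg x)) f1 g1 hf1 hg1 ?_
  · rw [← ofReal_integral_eq_lintegral_ofReal (hf.integrable.const_mul _)
        (ae_of_all _ fun x => mul_nonneg (by positivity) (hf.nonneg x)),
      ← ofReal_integral_eq_lintegral_ofReal (hg.integrable.const_mul _)
        (ae_of_all _ fun x => mul_nonneg (by positivity) (hg.nonneg x)),
      ← ofReal_integral_eq_lintegral_ofReal (hr.integrable.const_mul _)
        (ae_of_all _ fun x => mul_nonneg (by positivity) (hr.nonneg x)),
      integral_const_mul, integral_const_mul, integral_const_mul,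
      ← ENNReal.ofReal_add (by positivity) (by positivity),
      show (2 : ENNReal) = ENNReal.ofReal 2 by simp, ← ENNReal.ofReal_mul (by norm_num)] at key
    have hR : 0 ≤ ∫ x, r x := integral_nonneg hr.nonneg
    exact (ENNReal.ofReal_le_ofReal_iff (by positivity)).1 key
  · intro x y
    rcases le_or_gt (min (α ^ n * f x) (β ^ n * g y)) 0 with h0 | h0
    · exact h0.trans (mul_nonneg (by positivity) (hr.nonneg _))
    obtain ⟨θ, hθ, h⟩ := exists_pos_inv_pow_eq hn h0
    have h1 : ((α * θ) ^ n)⁻¹ ≤ f x := by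
      rw [mul_pow, mul_inv, h, inv_mul_le_iff₀ (by positivity)]
      exact min_le_left _ _
    have h2 : ((β * θ) ^ n)⁻¹ ≤ g y := by
      rw [mul_pow, mul_inv, h, inv_mul_le_iff₀ (by positivity)]
      exact min_le_right _ _
    have h3 := H x y _ _ (by positivity) (by positivity) h1 h2
    rw [show (α * θ + β * θ) / 2 = (α + β) / 2 * θ by ring, mul_pow, mul_inv, h,
      inv_mul_le_iff₀ (by positivity), smul_eq_mul, inv_mul_eq_div] at h3
    exact h3

lemma MidpointPowerMean.min_integral_le {f g r : ℝ → ℝ}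
    (H : MidpointPowerMean 1 f g r) (hf : BoundedDensity f) (hg : BoundedDensity g)
    (hr : BoundedDensity r) :
    min (∫ x, f x) (∫ x, g x) ≤ ∫ x, r x := by
  have hR : 0 ≤ ∫ x, r x := integral_nonneg hr.nonneg
  rcases le_or_gt (∫ x, f x) 0 with fp | fp
  · exact (min_le_left _ _).trans (fp.trans hR)
  rcases le_or_gt (∫ x, g x) 0 with gp | gp
  · exact (min_le_right _ _).trans (gp.trans hR)
  obtain ⟨α, β, hα, hβ, h⟩ := H.exists_integral_le one_ne_zero hf hg hr fp gp
  simp only [pow_one] at h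
  have h1 := mul_le_mul_of_nonneg_left (min_le_left (∫ x, f x) (∫ x, g x)) hα.le
  have h2 := mul_le_mul_of_nonneg_left (min_le_right (∫ x, f x) (∫ x, g x)) hβ.le
  refine le_of_mul_le_mul_left ?_ (add_pos hα hβ)
  linarith

lemma mul_add_pow_three_le {α β F G : ℝ} (hα : 0 < α) (hβ : 0 < β) (hF : 0 < F) (hG : 0 < G) :
    F * G * (α + β) ^ 3 ≤ 2 * ((α ^ 3 * F + β ^ 3 * G) * (F + G)) := by
  obtain ⟨a, ha, rfl⟩ : ∃ a, 0 < a ∧ a ^ 2 = α := ⟨√α, by positivity, Real.sq_sqrt hα.le⟩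
  obtain ⟨b, hb, rfl⟩ : ∃ b, 0 < b ∧ b ^ 2 = β := ⟨√β, by positivity, Real.sq_sqrt hβ.le⟩
  have h1 : F * G * (a ^ 3 + b ^ 3) ^ 2 ≤ ((a ^ 2) ^ 3 * F + (b ^ 2) ^ 3 * G) * (F + G) := by
    nlinarith [sq_nonneg (a ^ 3 * F - b ^ 3 * G)]
  have h2 : (a ^ 2 + b ^ 2) ^ 3 ≤ 2 * (a ^ 3 + b ^ 3) ^ 2 := by
    have : 2 * (a ^ 3 + b ^ 3) ^ 2 - (a ^ 2 + b ^ 2) ^ 3 =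
        (a - b) ^ 2 * (a ^ 4 + 2 * a ^ 3 * b + 2 * a * b ^ 3 + b ^ 4) := by ring
    have : 0 ≤ (a - b) ^ 2 * (a ^ 4 + 2 * a ^ 3 * b + 2 * a * b ^ 3 + b ^ 4) := by positivity
    linarith
  calc F * G * (a ^ 2 + b ^ 2) ^ 3 ≤ F * G * (2 * (a ^ 3 + b ^ 3) ^ 2) := by gcongr
    _ ≤ _ := by linarith

lemma MidpointPowerMean.inv_le_integral {f g r : ℝ → ℝ}
    (H : MidpointPowerMean 3 f g r) (hf : BoundedDensity f) (hg : BoundedDensity g)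
    (hr : BoundedDensity r) {a b : ℝ} (ha : 0 < a) (hb : 0 < b)
    (haf : a⁻¹ ≤ ∫ x, f x) (hbg : b⁻¹ ≤ ∫ x, g x) :
    ((a + b) / 2)⁻¹ ≤ ∫ x, r x := by
  have fp : 0 < ∫ x, f x := lt_of_lt_of_le (by positivity) haf
  have gp : 0 < ∫ x, g x := lt_of_lt_of_le (by positivity) hbg
  obtain ⟨α, β, hα, hβ, h⟩ := H.exists_integral_le three_ne_zero hf hg hr fp gp
  have h1 := mul_add_pow_three_le hα hβ fp gp
  generalize (∫ x, f x) = F at *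
  generalize (∫ x, g x) = G at *
  generalize (∫ x, r x) = R at *
  have h2 : 2 * (F * G) ≤ R * (F + G) := by
    have hab : 0 < (α + β) ^ 3 := by positivity
    have := mul_le_mul_of_nonneg_right h (add_pos fp gp).le
    refine le_of_mul_le_mul_left ?_ hab
    nlinarith
  have h3 : F + G ≤ (a + b) * (F * G) := by
    rw [inv_le_iff_one_le_mul₀ ha] at haf
    rw [inv_le_iff_one_le_mul₀ hb] at hbg
    nlinarith
  have hR : 0 < R := by
    by_contra! hR
    nlinarith [mul_pos fp gp, mul_nonneg_of_nonpos_of_nonpos hR (neg_nonpos.2 (add_pos fp gp).le)]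
  rw [inv_le_iff_one_le_mul₀ (by positivity)]
  have : 2 * (F * G) ≤ R * ((a + b) * (F * G)) := h2.trans (by gcongr)
  refine le_of_mul_le_mul_left ?_ (mul_pos fp gp)
  linarith

lemma MidpointPowerMean.marginal {u v w : ℝ × ℝ → ℝ} (H : MidpointPowerMean 3 u v w)
    (hu : BoundedDensity u) (hv : BoundedDensity v) (hw : BoundedDensity w) :
    MidpointPowerMean 1 (fun s => ∫ y, u (s, y)) (fun s => ∫ y, v (s, y))
      (fun s => ∫ y, w (s, y)) := by
  intro s t a b ha hb hsa htb
  rw [pow_one] at *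
  have : MidpointPowerMean 3 (fun y => u (s, y)) (fun y => v (t, y))
      (fun y => w ((2 : ℝ)⁻¹ • (s + t), y)) :=
    fun x y α β hα hβ hx hy => H (s, x) (t, y) α β hα hβ hx hy
  exact this.inv_le_integral (hu.slice s) (hv.slice t) (hw.slice _) ha hb hsa htb

/-- A planar case of the Borell–Brascamp–Lieb inequality. -/
lemma MidpointPowerMean.min_integral_prod_le {u v w : ℝ × ℝ → ℝ} (H : MidpointPowerMean 3 u v w)
    (hu : BoundedDensity u) (hv : BoundedDensity v) (hw : BoundedDensity w) :
    min (∫ p, u p) (∫ p, v p) ≤ ∫ p, w p := by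
  rw [Measure.volume_eq_prod, integral_prod _ hu.integrable, integral_prod _ hv.integrable,
    integral_prod _ hw.integrable]
  exact (H.marginal hu hv hw).min_integral_le hu.marginal hv.marginal hw.marginal

/-- The Borell–Brascamp–Lieb inequality in the Euclidean plane. -/
lemma MidpointPowerMean.min_integral_euc_le {u v w : Euc 2 → ℝ}
    (H : MidpointPowerMean 3 u v w)
    (hu : BoundedDensity u) (hv : BoundedDensity v) (hw : BoundedDensity w) :
    min (∫ p, u p) (∫ p, v p) ≤ ∫ p, w p := by
  let e : Euc 2 ≃ᵐ ℝ × ℝ :=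
    (MeasurableEquiv.toLp 2 (Fin 2 → ℝ)).symm.trans MeasurableEquiv.finTwoArrow
  have he : MeasurePreserving e.symm :=
    ((volume_preserving_finTwoArrow ℝ).comp
      (EuclideanSpace.volume_preserving_symm_measurableEquiv_toLp (Fin 2))).symm e
  have hsymm : ∀ p : ℝ × ℝ, e.symm p = !₂[p.1, p.2] := fun p => rfl
  have hnorm : ∀ p : ℝ × ℝ, ‖p‖ ≤ ‖e.symm p‖ := fun p => by
    rw [Prod.norm_def, hsymm]
    exact max_le (PiLp.norm_apply_le !₂[p.1, p.2] 0) (PiLp.norm_apply_le !₂[p.1, p.2] 1)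
  have hmid : ∀ p q : ℝ × ℝ, e.symm ((2 : ℝ)⁻¹ • (p + q)) =
      (2 : ℝ)⁻¹ • (e.symm p + e.symm q) := fun p q => by
    ext i
    fin_cases i <;> simp [hsymm]
  have hb : ∀ q : Euc 2 → ℝ, BoundedDensity q →
      BoundedDensity (fun p => q (e.symm p)) := fun q hq => by
    obtain ⟨C, R, h⟩ := hq.exists_bound
    exact ⟨hq.measurable.comp e.symm.measurable, fun p => hq.nonneg _, C, R, fun p =>
      ⟨(h _).1, fun hp => (h _).2 (hp.trans_le (hnorm p))⟩⟩
  rw [← he.integral_comp' u, ← he.integral_comp' v, ← he.integral_comp' w]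
  refine MidpointPowerMean.min_integral_prod_le (fun p q α β hα hβ hp hq => ?_)
    (hb u hu) (hb v hv) (hb w hw)
  rw [hmid]
  exact H _ _ α β hα hβ hp hq

/-- The distance in space from the origin to the point at height `h` above `z`. -/
def slantDist (h : ℝ) (z : Euc 2) : ℝ := √(‖z‖ ^ 2 + h ^ 2)

lemma continuous_slantDist (h : ℝ) : Continuous (slantDist h) := by
  unfold slantDist
  fun_prop

lemma le_slantDist (h : ℝ) (z : Euc 2) : h ≤ slantDist h z :=
  Real.le_sqrt_of_sq_le (by nlinarith [sq_nonneg ‖z‖])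

lemma slantDist_pos {h : ℝ} (hh : 0 < h) (z : Euc 2) : 0 < slantDist h z :=
  hh.trans_le (le_slantDist h z)

lemma norm_le_slantDist (h : ℝ) (z : Euc 2) : ‖z‖ ≤ slantDist h z :=
  Real.le_sqrt_of_sq_le (by nlinarith [sq_nonneg h])

/-- The slant distance is strictly midpoint convex. -/
lemma slantDist_midpoint_lt {h : ℝ} (hh : 0 < h) {a b : Euc 2} (hab : a ≠ b) :
    slantDist h ((2 : ℝ)⁻¹ • (a + b)) < (slantDist h a + slantDist h b) / 2 := by
  have ha := slantDist_pos hh a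
  have hb := slantDist_pos hh b
  have ha2 : slantDist h a ^ 2 = ‖a‖ ^ 2 + h ^ 2 := Real.sq_sqrt (by positivity)
  have hb2 : slantDist h b ^ 2 = ‖b‖ ^ 2 + h ^ 2 := Real.sq_sqrt (by positivity)
  have hsub : 0 < ‖a‖ ^ 2 - 2 * ⟪a, b⟫ + ‖b‖ ^ 2 := by
    rw [← norm_sub_sq_real]
    have := norm_pos_iff.2 (sub_ne_zero.2 hab)
    positivity
  have hcs : ⟪a, b⟫ ^ 2 ≤ ‖a‖ ^ 2 * ‖b‖ ^ 2 := by
    rw [← mul_pow]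
    exact sq_le_sq' (neg_le_of_abs_le (abs_real_inner_le_norm a b)) (real_inner_le_norm a b)
  have hprod : ⟪a, b⟫ + h ^ 2 < slantDist h a * slantDist h b := by
    refine lt_of_pow_lt_pow_left₀ 2 (by positivity) ?_
    rw [mul_pow, ha2, hb2]
    nlinarith [mul_pos (pow_pos hh 2) hsub]
  have hmid : ‖(2 : ℝ)⁻¹ • (a + b)‖ ^ 2 = (‖a‖ ^ 2 + 2 * ⟪a, b⟫ + ‖b‖ ^ 2) / 4 := by
    rw [norm_smul, mul_pow, norm_add_sq_real]
    norm_num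
    ring
  rw [slantDist, Real.sqrt_lt' (by positivity), hmid]
  nlinarith

lemma slantDist_midpoint_le {h : ℝ} (hh : 0 < h) (a b : Euc 2) :
    slantDist h ((2 : ℝ)⁻¹ • (a + b)) ≤ (slantDist h a + slantDist h b) / 2 := by
  rcases eq_or_ne a b with rfl | hab
  · rw [← two_smul ℝ a, inv_smul_smul₀ two_ne_zero, add_self_div_two]
  · exact (slantDist_midpoint_lt hh hab).le

/-- The kernel of the solid-angle potential of `Ω` at `x`, with weight `g` and without the
factor `h`. -/
def weightedKernel (h : ℝ) (Ω : Set (Euc 2)) (g : Euc 2 → ℝ) (x : Euc 2) : Euc 2 → ℝ :=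
  Ω.indicator fun y => g y * (slantDist h (x - y) ^ 3)⁻¹

lemma boundedDensity_weightedKernel {h : ℝ} (hh : 0 < h) {Ω : Set (Euc 2)} (hΩ : IsCompact Ω)
    {g : Euc 2 → ℝ} (hg : Measurable g) (g0 : ∀ y, 0 ≤ g y) (g1 : ∀ y, g y ≤ 1) (x : Euc 2) :
    BoundedDensity (weightedKernel h Ω g x) := by
  obtain ⟨R, hR⟩ := hΩ.isBounded.subset_closedBall 0
  have hk : ∀ y, 0 < (slantDist h (x - y) ^ 3)⁻¹ := fun y => by
    have := slantDist_pos hh (x - y)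
    positivity
  have hm : Measurable fun y => slantDist h (x - y) :=
    ((continuous_slantDist h).comp (continuous_const.sub continuous_id)).measurable
  refine ⟨(hg.mul (hm.pow_const 3).inv).indicator hΩ.measurableSet,
    fun y => indicator_nonneg (fun y _ => mul_nonneg (g0 y) (hk y).le) y, (h ^ 3)⁻¹, R,
    fun y => ⟨?_, fun hy => ?_⟩⟩
  · refine indicator_apply_le' (fun _ => ?_) fun _ => by positivity
    calc g y * (slantDist h (x - y) ^ 3)⁻¹ ≤ 1 * (slantDist h (x - y) ^ 3)⁻¹ :=
          mul_le_mul_of_nonneg_right (g1 y) (hk y).le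
      _ ≤ (h ^ 3)⁻¹ := by
          rw [one_mul]
          have := le_slantDist h (x - y)
          gcongr
  · refine indicator_of_notMem (fun h' => ?_) _
    have := hR h'
    rw [mem_closedBall_zero_iff] at this
    linarith

lemma apot_two_eq (h : ℝ) {Ω : Set (Euc 2)} (hΩ : IsCompact Ω) (x : Euc 2) :
    apot 2 Ω x h = h * ∫ y, weightedKernel h Ω 1 x y := by
  rw [apot, weightedKernel, integral_indicator hΩ.measurableSet, ← integral_const_mul]
  refine integral_congr_ae (ae_of_all _ fun y => ?_)
  simp only [Pi.one_apply, one_mul]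
  rw [div_eq_mul_inv, slantDist, Real.sqrt_eq_rpow, ← Real.rpow_mul_natCast (by positivity),
    dist_eq_norm]
  norm_num

lemma boundedDensity_weightedKernel_one {h : ℝ} (hh : 0 < h) {Ω : Set (Euc 2)}
    (hΩ : IsCompact Ω) (x : Euc 2) : BoundedDensity (weightedKernel h Ω 1 x) :=
  boundedDensity_weightedKernel hh hΩ measurable_one (fun _ => zero_le_one) (fun _ => le_rfl) x

/-- Existence of an illuminating center. -/
lemma exists_isMax_apot {h : ℝ} (hh : 0 < h) {Ω : Set (Euc 2)} (hΩ : IsCompact Ω)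
    (hint : (interior Ω).Nonempty) : ∃ x : Euc 2, ∀ y : Euc 2, apot 2 Ω y h ≤ apot 2 Ω x h := by
  let F : Euc 2 → ℝ := fun x => ∫ y, weightedKernel h Ω 1 x y
  suffices ∃ x, ∀ y, F y ≤ F x by
    obtain ⟨x, hx⟩ := this
    refine ⟨x, fun y => ?_⟩
    rw [apot_two_eq h hΩ, apot_two_eq h hΩ]
    exact mul_le_mul_of_nonneg_left (hx y) hh.le
  have hmeas : ∀ x, AEStronglyMeasurable (weightedKernel h Ω 1 x) volume := fun x =>
    (boundedDensity_weightedKernel_one hh hΩ x).measurable.aestronglyMeasurable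
  have hbound : ∀ x, ∀ᵐ y, ‖weightedKernel h Ω 1 x y‖ ≤ Ω.indicator (fun _ => (h ^ 3)⁻¹) y :=
    fun x => ae_of_all _ fun y => by
      rw [Real.norm_of_nonneg ((boundedDensity_weightedKernel_one hh hΩ x).nonneg y)]
      refine indicator_le_indicator ?_
      rw [Pi.one_apply, one_mul]
      have := le_slantDist h (x - y)
      gcongr
  have hbi : Integrable (Ω.indicator fun _ : Euc 2 => (h ^ 3)⁻¹) :=
    (integrable_indicator_iff hΩ.measurableSet).2 (integrableOn_const hΩ.measure_ne_top)
  have hcont : Continuous F := by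
    refine continuous_of_dominated hmeas hbound hbi (ae_of_all _ fun y => ?_)
    by_cases hy : y ∈ Ω
    · simp only [weightedKernel, indicator_of_mem hy, Pi.one_apply, one_mul]
      exact (((continuous_slantDist h).comp (continuous_id.sub continuous_const)).pow 3).inv₀
        fun x => (pow_pos (slantDist_pos hh _) 3).ne'
    · simp only [weightedKernel, indicator_of_notMem hy]
      exact continuous_const
  have hgen : (cocompact (Euc 2)).IsCountablyGenerated := by
    rw [← cobounded_eq_cocompact, ← comap_norm_atTop]
    infer_instance
  have hlim : Tendsto F (cocompact (Euc 2)) (𝓝 0) := by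
    rw [← integral_zero (Euc 2) ℝ]
    refine tendsto_integral_filter_of_dominated_convergence _ (Eventually.of_forall hmeas)
      (Eventually.of_forall hbound) hbi (ae_of_all _ fun y => ?_)
    by_cases hy : y ∈ Ω
    · simp only [weightedKernel, indicator_of_mem hy, Pi.one_apply, one_mul]
      refine tendsto_inv_atTop_zero.comp ((tendsto_pow_atTop three_ne_zero).comp ?_)
      refine tendsto_atTop_mono (fun x => (norm_sub_norm_le x y).trans
        (norm_le_slantDist h (x - y))) ?_
      exact tendsto_atTop_add_const_right _ (-‖y‖) tendsto_norm_cocompact_atTop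
    · simp only [weightedKernel, indicator_of_notMem hy]
      exact tendsto_const_nhds
  have hpos : 0 < F 0 := by
    have hd := boundedDensity_weightedKernel_one hh hΩ 0
    refine (integral_pos_iff_support_of_nonneg hd.nonneg hd.integrable).2 ?_
    refine (isOpen_interior.measure_pos volume hint).trans_le (measure_mono fun y hy => ?_)
    rw [Function.mem_support, weightedKernel, indicator_of_mem (interior_subset hy),
      Pi.one_apply, one_mul]
    have := slantDist_pos hh (0 - y)
    positivity
  exact hcont.exists_forall_ge' 0 ((hlim.eventually_lt_const hpos).mono fun x hx => hx.le)

/-- The solid-angle potential of a planar convex body is strictly quasiconcave at midpoints. -/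
lemma min_apot_lt_apot_midpoint {h : ℝ} (hh : 0 < h) {Ω : Set (Euc 2)} (hΩ : IsCompact Ω)
    (hconv : Convex ℝ Ω) (hint : (interior Ω).Nonempty) {a b : Euc 2} (hab : a ≠ b) :
    min (apot 2 Ω a h) (apot 2 Ω b h) < apot 2 Ω ((2 : ℝ)⁻¹ • (a + b)) h := by
  set m := (2 : ℝ)⁻¹ • (a + b) with hm
  set f : Euc 2 → ℝ := fun y => ⟪y, a - b⟫ with hf
  have hfc : Continuous f := by fun_prop
  have hd : 0 < ‖a - b‖ ^ 2 := by
    have := norm_pos_iff.2 (sub_ne_zero.2 hab)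
    positivity
  obtain ⟨y₀, hy₀, hmax⟩ := hΩ.exists_isMaxOn (hint.mono interior_subset) hfc.continuousOn
  set c := f y₀ - ‖a - b‖ ^ 2 / 4 with hc
  have hmid : ∀ p q : Euc 2,
      m - (2 : ℝ)⁻¹ • (p + q) = (2 : ℝ)⁻¹ • ((a - p) + (b - q)) := fun p q => by
    rw [hm]
    module
  obtain ⟨θ, hθ0, hθ1, hθ⟩ : ∃ θ : ℝ, 0 < θ ∧ θ < 1 ∧ ∀ p ∈ Ω, ∀ q ∈ Ω,
      c ≤ f ((2 : ℝ)⁻¹ • (p + q)) → slantDist h (m - (2 : ℝ)⁻¹ • (p + q)) ≤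
        θ * ((slantDist h (a - p) + slantDist h (b - q)) / 2) := by
    let K : Set (Euc 2 × Euc 2) := (Ω ×ˢ Ω) ∩ {z | c ≤ f ((2 : ℝ)⁻¹ • (z.1 + z.2))}
    have hK : IsCompact K := (hΩ.prod hΩ).inter_right
      (isClosed_le continuous_const (hfc.comp (by fun_prop)))
    have hden : ∀ z : Euc 2 × Euc 2,
        0 < (slantDist h (a - z.1) + slantDist h (b - z.2)) / 2 := fun z =>
      half_pos (add_pos (slantDist_pos hh _) (slantDist_pos hh _))
    let φ : Euc 2 × Euc 2 → ℝ := fun z => slantDist h (m - (2 : ℝ)⁻¹ • (z.1 + z.2)) /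
      ((slantDist h (a - z.1) + slantDist h (b - z.2)) / 2)
    have hφ : Continuous φ := by
      have := continuous_slantDist h
      refine Continuous.div (by fun_prop) (by fun_prop) fun z => (hden z).ne'
    have hy₀K : (y₀, y₀) ∈ K := by
      refine ⟨⟨hy₀, hy₀⟩, ?_⟩
      rw [mem_ofPred_eq, ← two_smul ℝ y₀, inv_smul_smul₀ two_ne_zero]
      linarith
    obtain ⟨z, hzK, hz⟩ := hK.exists_isMaxOn ⟨_, hy₀K⟩ hφ.continuousOn
    refine ⟨φ z, div_pos (slantDist_pos hh _) (hden z), ?_, fun p hp q hq hpq => ?_⟩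
    · rw [div_lt_one (hden z), hmid]
      refine slantDist_midpoint_lt hh fun heq => ?_
      have h1 : f ((2 : ℝ)⁻¹ • (z.1 + z.2)) = f z.1 - ‖a - b‖ ^ 2 / 2 := by
        have : (2 : ℝ)⁻¹ • (z.1 + z.2) = z.1 - (2 : ℝ)⁻¹ • (a - b) := by
          have : z.2 = b - a + z.1 := by
            rw [← sub_eq_zero] at heq ⊢
            rw [← heq]
            abel
          rw [this]
          module
        rw [hf]
        simp only [this, inner_sub_left, real_inner_smul_left, ← real_inner_self_eq_norm_sq]
        ring
      have h2 : c ≤ f ((2 : ℝ)⁻¹ • (z.1 + z.2)) := hzK.2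
      have h3 : f z.1 ≤ f y₀ := hmax hzK.1.1
      linarith
    · have : φ (p, q) ≤ φ z := hz ⟨⟨hp, hq⟩, hpq⟩
      exact (div_le_iff₀ (hden (p, q))).1 this
  set g : Euc 2 → ℝ := ({y | c ≤ f y} : Set (Euc 2)).piecewise (fun _ => θ ^ 3) 1
  have hcap : MeasurableSet {y | c ≤ f y} := measurableSet_le measurable_const hfc.measurable
  have hgm : Measurable g := Measurable.piecewise hcap measurable_const measurable_one
  have hg_cap : ∀ y, c ≤ f y → g y = θ ^ 3 := fun y hy => piecewise_eq_of_mem _ _ _ hy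
  have hg_compl : ∀ y, ¬ c ≤ f y → g y = 1 := fun y hy => piecewise_eq_of_notMem _ _ _ hy
  have hθ3 : θ ^ 3 < 1 := pow_lt_one₀ hθ0.le hθ1 three_ne_zero
  have g0 : ∀ y, 0 ≤ g y := fun y => by
    by_cases hy : c ≤ f y
    · rw [hg_cap y hy]
      positivity
    · rw [hg_compl y hy]
      exact zero_le_one
  have g1 : ∀ y, g y ≤ 1 := fun y => by
    by_cases hy : c ≤ f y
    · rw [hg_cap y hy]
      exact hθ3.le
    · rw [hg_compl y hy]
  have hwd := boundedDensity_weightedKernel hh hΩ hgm g0 g1 m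
  have hud := boundedDensity_weightedKernel_one hh hΩ
  have hkernel : ∀ x y : Euc 2, ∀ α : ℝ, 0 < α → (α ^ 3)⁻¹ ≤ weightedKernel h Ω 1 x y →
      y ∈ Ω ∧ slantDist h (x - y) ≤ α := fun x y α hα hle => by
    have hy : y ∈ Ω := by
      by_contra hy
      rw [weightedKernel, indicator_of_notMem hy] at hle
      have : 0 < (α ^ 3)⁻¹ := by positivity
      linarith
    refine ⟨hy, ?_⟩
    have hs := slantDist_pos hh (x - y)
    rw [weightedKernel, indicator_of_mem hy, Pi.one_apply, one_mul,
      inv_le_inv₀ (by positivity) (by positivity)] at hle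
    exact le_of_pow_le_pow_left₀ three_ne_zero hα.le hle
  have hmean : MidpointPowerMean 3 (weightedKernel h Ω 1 a) (weightedKernel h Ω 1 b)
      (weightedKernel h Ω g m) := by
    intro p q α β hα hβ hp hq
    obtain ⟨hpΩ, hpα⟩ := hkernel a p α hα hp
    obtain ⟨hqΩ, hqβ⟩ := hkernel b q β hβ hq
    have hpq : (2 : ℝ)⁻¹ • (p + q) ∈ Ω := by
      rw [smul_add]
      exact hconv hpΩ hqΩ (by norm_num) (by norm_num) (by norm_num)
    have hs := slantDist_pos hh (m - (2 : ℝ)⁻¹ • (p + q))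
    rw [weightedKernel, indicator_of_mem hpq]
    by_cases hy : c ≤ f ((2 : ℝ)⁻¹ • (p + q))
    · rw [hg_cap _ hy, ← div_eq_mul_inv, ← div_pow, ← inv_pow]
      have h1 := hθ p hpΩ q hqΩ hy
      have h2 : slantDist h (m - (2 : ℝ)⁻¹ • (p + q)) ≤ θ * ((α + β) / 2) :=
        h1.trans (by gcongr)
      gcongr
      rw [inv_le_iff_one_le_mul₀ (by positivity), ← mul_div_right_comm, one_le_div hs]
      exact h2
    · rw [hg_compl _ hy, one_mul]
      have h1 := slantDist_midpoint_le hh (a - p) (b - q)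
      rw [← hmid] at h1
      have h2 : slantDist h (m - (2 : ℝ)⁻¹ • (p + q)) ≤ (α + β) / 2 := h1.trans (by gcongr)
      gcongr
  have hle := hmean.min_integral_euc_le (hud a) (hud b) hwd
  have hlt : ∫ y, weightedKernel h Ω g m y < ∫ y, weightedKernel h Ω 1 m y := by
    rw [← sub_pos, ← integral_sub (hud m).integrable hwd.integrable]
    have hdiff : ∀ y, (weightedKernel h Ω 1 m - weightedKernel h Ω g m) y =
        Ω.indicator (fun y => (1 - g y) * (slantDist h (m - y) ^ 3)⁻¹) y := fun y => by
      by_cases hy : y ∈ Ω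
      · simp only [Pi.sub_apply, weightedKernel, indicator_of_mem hy, Pi.one_apply]
        ring
      · simp only [Pi.sub_apply, weightedKernel, indicator_of_notMem hy, sub_zero]
    refine (integral_pos_iff_support_of_nonneg (fun y => ?_)
      ((hud m).integrable.sub hwd.integrable)).2 ?_
    · rw [hdiff]
      refine indicator_nonneg (fun y _ => mul_nonneg (sub_nonneg.2 (g1 y)) ?_) y
      have := slantDist_pos hh (m - y)
      positivity
    · have hU : IsOpen (interior Ω ∩ {y | c < f y}) :=
        isOpen_interior.inter (isOpen_lt continuous_const hfc)
      have hUne : (interior Ω ∩ {y | c < f y}).Nonempty := by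
        have hcl : y₀ ∈ closure (interior Ω) := by
          rw [hconv.closure_interior_eq_closure_of_nonempty_interior hint]
          exact subset_closure hy₀
        rw [inter_comm]
        refine mem_closure_iff.1 hcl _ (isOpen_lt continuous_const hfc) ?_
        rw [mem_ofPred_eq]
        linarith
      refine (hU.measure_pos volume hUne).trans_le (measure_mono fun y hy => ?_)
      rw [Function.mem_support, hdiff, indicator_of_mem (interior_subset hy.1),
        hg_cap y (le_of_lt hy.2)]
      have := slantDist_pos hh (m - y)
      have := sub_pos.2 hθ3
      positivity
  rw [apot_two_eq h hΩ, apot_two_eq h hΩ, apot_two_eq h hΩ, ← mul_min_of_nonneg _ _ hh.le]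
  exact mul_lt_mul_of_pos_left (hle.trans_lt hlt) hh

/-- A planar convex body has exactly one illuminating center of each height. -/
lemma existsUnique_isMax_apot {h : ℝ} (hh : 0 < h) {Ω : Set (Euc 2)} (hΩ : IsCompact Ω)
    (hconv : Convex ℝ Ω) (hint : (interior Ω).Nonempty) :
    ∃! x : Euc 2, ∀ y : Euc 2, apot 2 Ω y h ≤ apot 2 Ω x h := by
  obtain ⟨x, hx⟩ := exists_isMax_apot hh hΩ hint
  refine ⟨x, hx, fun z hz => ?_⟩
  by_contra hne
  have hlt := min_apot_lt_apot_midpoint hh hΩ hconv hint hne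
  rcases min_lt_iff.1 hlt with hlt | hlt
  · exact absurd (hz _) (not_le.2 hlt)
  · exact absurd (hx _) (not_le.2 hlt)

/-- uniqueness of an illuminating center of a non-obtuse triangle for every
height `h > 0`. -/
theorem unique_illuminating_center_triangle (A B C : Euc 2)
    (hindep : AffineIndependent ℝ ![A, B, C])
    (hA : 0 ≤ ⟪B - A, C - A⟫) (hB : 0 ≤ ⟪A - B, C - B⟫) (hC : 0 ≤ ⟪A - C, B - C⟫)
    (Ω : Set (Euc 2)) (hΩ : Ω = convexHull ℝ {A, B, C})
    (h : ℝ) (hh : 0 < h) :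
    ∃! x : Euc 2, ∀ y : Euc 2, apot 2 Ω y h ≤ apot 2 Ω x h := by
  subst hΩ
  refine existsUnique_isMax_apot hh ((toFinite {A, B, C}).isCompact_convexHull ℝ)
    (convex_convexHull ℝ _) ?_
  rw [interior_convexHull_nonempty_iff_affineSpan_eq_top]
  have hrange : range ![A, B, C] = {A, B, C} := by
    rw [Matrix.range_cons, Matrix.range_cons_cons_empty, singleton_union]
  rw [← hrange, hindep.affineSpan_eq_top_iff_card_eq_finrank_add_one]
  simp
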